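/- Let N ≥ 2 and ψ ∈ 𝓕ᴺ. Then R_N(ψ) = Q₀ᴺ if and only if, for every n = 1,…,N−1, the inequalities 1{lₙ < Qₙᴺ} ≤ ψₙ ≤ 1{lₙ ≤ Qₙᴺ} hold μⁿ-almost everywhere on Tₙ^ψ = {tₙ^ψ > 0}. -/

import Mathlib

open MeasureTheory ENNReal Filter ProbabilityTheory

namespace SDP

variable {Θ X D : Type*} [MeasurableSpace Θ] [MeasurableSpace X] [MeasurableSpace D]

/-- The product measure `μⁿ` on `Xⁿ`. -/
noncomputable def pm (μ : Measure X) (n : ℕ) : Measure (Fin n → X) :=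
  Measure.pi fun _ => μ

/-- `t_n^ψ = (1-ψ₁)⋯(1-ψ_{n-1})`, with `t₁^ψ ≡ 1`. -/
noncomputable def t (ψ : ∀ n, (Fin n → X) → ℝ≥0∞) : ∀ n, (Fin n → X) → ℝ≥0∞
  | 0, _ => 1
  | 1, _ => 1
  | n + 2, x => t ψ (n + 1) (Fin.init x) * (1 - ψ (n + 1) (Fin.init x))

/-- `s_n^ψ = (1-ψ₁)⋯(1-ψ_{n-1})ψ_n`. -/
noncomputable def s (ψ : ∀ n, (Fin n → X) → ℝ≥0∞) (n : ℕ) (x : Fin n → X) : ℝ≥0∞ :=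
  t ψ n x * ψ n x

/-- A stopping rule: a sequence of measurable functions with values in `[0,1]`. -/
def IsStoppingRule (ψ : ∀ n, (Fin n → X) → ℝ≥0∞) : Prop :=
  (∀ n, Measurable (ψ n)) ∧ ∀ n x, ψ n x ≤ 1

/-- A decision rule: a sequence of measurable functions with values in `D`. -/
def IsDecisionRule (δ : ∀ n, (Fin n → X) → D) : Prop := ∀ n, Measurable (δ n)

/-- `ψ` is truncated at `N`: `ψ_n ≡ 1` for all `n ≥ N`. -/
def TruncatedAt (ψ : ∀ n, (Fin n → X) → ℝ≥0∞) (N : ℕ) : Prop :=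
  ∀ n, N ≤ n → ∀ x, ψ n x = 1

/-- A consistent family of joint probability densities `f_θⁿ` w.r.t. `μⁿ`. -/
def IsDensityFamily (μ : Measure X) (f : Θ → ∀ n, (Fin n → X) → ℝ≥0∞) : Prop :=
  (∀ n, Measurable fun p : Θ × (Fin n → X) => f p.1 n p.2) ∧
  (∀ θ x, f θ 0 x = 1) ∧
  (∀ θ n, ∫⁻ x, f θ n x ∂pm μ n = 1) ∧
  ∀ θ n (x : Fin n → X), ∫⁻ y, f θ (n + 1) (Fin.snoc x y) ∂μ = f θ n x

/-- The average loss `W(ψ,δ)`. -/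
noncomputable def W (π₁ : Measure Θ) (μ : Measure X) (w : Θ → D → ℝ≥0∞)
    (f : Θ → ∀ n, (Fin n → X) → ℝ≥0∞) (ψ : ∀ n, (Fin n → X) → ℝ≥0∞)
    (δ : ∀ n, (Fin n → X) → D) : ℝ≥0∞ :=
  ∑' n : ℕ, ∫⁻ θ, ∫⁻ x, s ψ (n + 1) x * w θ (δ (n + 1) x) * f θ (n + 1) x ∂pm μ (n + 1) ∂π₁

/-- The partial average loss `W_i(ψ,δ)` (integration over `Θᵢ`). -/
noncomputable def Wi (π₁ : Measure Θ) (μ : Measure X) (w : Θ → D → ℝ≥0∞)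
    (f : Θ → ∀ n, (Fin n → X) → ℝ≥0∞) (Θi : Set Θ) (ψ : ∀ n, (Fin n → X) → ℝ≥0∞)
    (δ : ∀ n, (Fin n → X) → D) : ℝ≥0∞ :=
  ∑' n : ℕ,
    ∫⁻ θ in Θi, ∫⁻ x, s ψ (n + 1) x * w θ (δ (n + 1) x) * f θ (n + 1) x ∂pm μ (n + 1) ∂π₁

/-- `P^{π}(τ_ψ = n)`. -/
noncomputable def PtauEq (π₂ : Measure Θ) (μ : Measure X)
    (f : Θ → ∀ n, (Fin n → X) → ℝ≥0∞) (ψ : ∀ n, (Fin n → X) → ℝ≥0∞) (n : ℕ) : ℝ≥0∞ :=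
  ∫⁻ θ, ∫⁻ x, s ψ n x * f θ n x ∂pm μ n ∂π₂

/-- `P^{π}(τ_ψ < ∞)`. -/
noncomputable def Pfin (π₂ : Measure Θ) (μ : Measure X)
    (f : Θ → ∀ n, (Fin n → X) → ℝ≥0∞) (ψ : ∀ n, (Fin n → X) → ℝ≥0∞) : ℝ≥0∞ :=
  ∑' n : ℕ, PtauEq π₂ μ f ψ (n + 1)

/-- The average sample number `N(ψ)` (equal to `∞` if `P^{π₂}(τ_ψ < ∞) < 1`). -/
noncomputable def ASN (π₂ : Measure Θ) (μ : Measure X)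
    (f : Θ → ∀ n, (Fin n → X) → ℝ≥0∞) (ψ : ∀ n, (Fin n → X) → ℝ≥0∞) : ℝ≥0∞ :=
  if Pfin π₂ μ f ψ = 1 then ∑' n : ℕ, ((n : ℝ≥0∞) + 1) * PtauEq π₂ μ f ψ (n + 1) else ⊤

/-- `fⁿ = ∫_Θ f_θⁿ dπ₂(θ)` (in particular `f⁰ ≡ 1`). -/
noncomputable def fbar (π₂ : Measure Θ) (f : Θ → ∀ n, (Fin n → X) → ℝ≥0∞)
    (n : ℕ) (x : Fin n → X) : ℝ≥0∞ :=
  ∫⁻ θ, f θ n x ∂π₂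

/-- `R(ψ) = Σₙ ∫ sₙ^ψ (c n fⁿ + lₙ) dμⁿ` if `P^{π₂}(τ_ψ<∞) = 1`, `∞` otherwise. -/
noncomputable def R (π₂ : Measure Θ) (μ : Measure X) (c : ℝ≥0∞)
    (f : Θ → ∀ n, (Fin n → X) → ℝ≥0∞) (l : ∀ n, (Fin n → X) → ℝ≥0∞)
    (ψ : ∀ n, (Fin n → X) → ℝ≥0∞) : ℝ≥0∞ :=
  if Pfin π₂ μ f ψ = 1 then
    ∑' n : ℕ, ∫⁻ x, s ψ (n + 1) x *
      (c * ((n : ℝ≥0∞) + 1) * fbar π₂ f (n + 1) x + l (n + 1) x) ∂pm μ (n + 1)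
  else ⊤

/-- `R_N(ψ)`, the risk of `ψ` truncated at `N`. -/
noncomputable def RN (π₂ : Measure Θ) (μ : Measure X) (c : ℝ≥0∞)
    (f : Θ → ∀ n, (Fin n → X) → ℝ≥0∞) (l : ∀ n, (Fin n → X) → ℝ≥0∞)
    (N : ℕ) (ψ : ∀ n, (Fin n → X) → ℝ≥0∞) : ℝ≥0∞ :=
  (∑ n ∈ Finset.range (N - 1), ∫⁻ x, s ψ (n + 1) x *
      (c * ((n : ℝ≥0∞) + 1) * fbar π₂ f (n + 1) x + l (n + 1) x) ∂pm μ (n + 1)) +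
  ∫⁻ x, t ψ N x * (c * (N : ℝ≥0∞) * fbar π₂ f N x + l N x) ∂pm μ N

/-- `Vₙᴺ`, defined backwards from `V_Nᴺ = l_N` by `Vₙᴺ = min{lₙ, Qₙᴺ}`. -/
noncomputable def V (μ : Measure X) (c : ℝ≥0∞) (fb l : ∀ n, (Fin n → X) → ℝ≥0∞)
    (N n : ℕ) (x : Fin n → X) : ℝ≥0∞ :=
  if h : n < N then
    min (l n x) (c * fb n x + ∫⁻ y, V μ c fb l N (n + 1) (Fin.snoc x y) ∂μ)
  else l n x
termination_by N - n
decreasing_by omega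

/-- `Qₙᴺ = c fⁿ + ∫ Vₙ₊₁ᴺ(⋅,y) dμ(y)`. -/
noncomputable def Q (μ : Measure X) (c : ℝ≥0∞) (fb l : ∀ n, (Fin n → X) → ℝ≥0∞)
    (N n : ℕ) (x : Fin n → X) : ℝ≥0∞ :=
  c * fb n x + ∫⁻ y, V μ c fb l N (n + 1) (Fin.snoc x y) ∂μ

/-- `Vₙ = lim_{N→∞} Vₙᴺ` (the sequence is nonincreasing in `N`, so the limit is the inf). -/
noncomputable def Vlim (μ : Measure X) (c : ℝ≥0∞) (fb l : ∀ n, (Fin n → X) → ℝ≥0∞)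
    (n : ℕ) (x : Fin n → X) : ℝ≥0∞ :=
  ⨅ N, V μ c fb l N n x

/-- `Qₙ = lim_{N→∞} Qₙᴺ = c fⁿ + ∫ Vₙ₊₁(⋅,y) dμ(y)`. -/
noncomputable def Qlim (μ : Measure X) (c : ℝ≥0∞) (fb l : ∀ n, (Fin n → X) → ℝ≥0∞)
    (n : ℕ) (x : Fin n → X) : ℝ≥0∞ :=
  c * fb n x + ∫⁻ y, Vlim μ c fb l (n + 1) (Fin.snoc x y) ∂μ

end SDP

namespace SDP

theorem left_lt_convexCombination {p a b : ℝ≥0∞} (hp : p < 1) (h : a < b) :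
    a < p * a + (1 - p) * b := by
  have ha : a ≠ ⊤ := h.ne_top
  calc a = p * a + (1 - p) * a := by rw [← add_mul, add_tsub_cancel_of_le hp.le, one_mul]
    _ < p * a + (1 - p) * b :=
      ENNReal.add_lt_add_left (ENNReal.mul_ne_top hp.ne_top ha)
        ((ENNReal.mul_lt_mul_iff_right (tsub_pos_of_lt hp).ne'
          (ne_top_of_le_ne_top one_ne_top tsub_le_self)).2 h)

theorem min_le_convexCombination {p : ℝ≥0∞} (hp : p ≤ 1) (a b : ℝ≥0∞) :
    min a b ≤ p * a + (1 - p) * b :=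
  calc min a b = p * min a b + (1 - p) * min a b := by
        rw [← add_mul, add_tsub_cancel_of_le hp, one_mul]
    _ ≤ p * a + (1 - p) * b := by gcongr <;> simp

theorem min_eq_convexCombination_iff {p : ℝ≥0∞} (hp : p ≤ 1) (a b : ℝ≥0∞) :
    min a b = p * a + (1 - p) * b ↔ (a < b → p = 1) ∧ (b < a → p = 0) := by
  rcases lt_trichotomy a b with h | rfl | h
  · rw [min_eq_left h.le]
    refine ⟨fun e => ⟨fun _ => ?_, fun h' => absurd h' h.not_gt⟩, fun e => ?_⟩
    · by_contra hne
      exact (left_lt_convexCombination (lt_of_le_of_ne hp hne) h).ne e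
    · simp [e.1 h]
  · simp [← add_mul, add_tsub_cancel_of_le hp]
  · rw [min_eq_right h.le]
    refine ⟨fun e => ⟨fun h' => absurd h' h.not_gt, fun _ => ?_⟩, fun e => ?_⟩
    · by_contra hne
      have h1 : 1 - p < 1 := ENNReal.sub_lt_self one_ne_top one_ne_zero hne
      have := left_lt_convexCombination h1 h
      rw [ENNReal.sub_sub_cancel one_ne_top hp, add_comm] at this
      exact this.ne e
    · simp [e.2 h]

theorem indicator_one_bounds_iff {α : Type*} {a b p : α → ℝ≥0∞} (x : α) (hp : p x ≤ 1) :
    ({y | a y < b y}.indicator 1 x ≤ p x ∧ p x ≤ {y | a y ≤ b y}.indicator 1 x) ↔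
      (a x < b x → p x = 1) ∧ (b x < a x → p x = 0) := by
  refine and_congr ?_ ?_
  · by_cases h : a x < b x
    · simp [Set.indicator, h, le_antisymm_iff, hp]
    · simp [Set.indicator, h]
  · by_cases h : a x ≤ b x
    · simp [Set.indicator, h, hp, h.not_gt]
    · simp [Set.indicator, h, not_le.1 h]

theorem weighted_convexCombination {τ p k a b : ℝ≥0∞} (hp : p ≤ 1) :
    τ * p * (k + a) + τ * (1 - p) * (k + b) = τ * (k + (p * a + (1 - p) * b)) := by
  calc _ = τ * ((p + (1 - p)) * k + (p * a + (1 - p) * b)) := by ring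
    _ = _ := by rw [add_tsub_cancel_of_le hp, one_mul]

theorem t_le_one {X : Type*} (ψ : ∀ n, (Fin n → X) → ℝ≥0∞) : ∀ n x, t ψ n x ≤ 1
  | 0, _ => by simp [t]
  | 1, _ => by simp [t]
  | n + 2, x => by
    simp only [t]
    exact mul_le_one' (t_le_one ψ (n + 1) _) tsub_le_self

theorem t_snoc {X : Type*} (ψ : ∀ n, (Fin n → X) → ℝ≥0∞) {n : ℕ} (hn : 1 ≤ n) (x : Fin n → X) (y : X) :
    t ψ (n + 1) (Fin.snoc x y) = t ψ n x * (1 - ψ n x) := by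
  obtain ⟨k, rfl⟩ := Nat.exists_eq_add_of_le' hn
  simp only [t, Fin.init_snoc]

section Integration

variable {X : Type*} [MeasurableSpace X]

theorem measurable_snoc (n : ℕ) :
    Measurable fun p : (Fin n → X) × X => (Fin.snoc p.1 p.2 : Fin (n + 1) → X) := by
  rw [measurable_pi_iff]
  intro i
  refine Fin.lastCases ?_ (fun j => ?_) i
  · simpa using measurable_snd
  · simpa using! (measurable_pi_apply j).comp measurable_fst

theorem measurable_init (n : ℕ) :
    Measurable fun x : Fin (n + 1) → X => (Fin.init x : Fin n → X) :=
  measurable_pi_iff.2 fun _ => measurable_pi_apply _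

instance pm.sigmaFinite (μ : Measure X) [SigmaFinite μ] (n : ℕ) : SigmaFinite (pm μ n) := by
  unfold pm; infer_instance

theorem lintegral_pm_succ (μ : Measure X) [SigmaFinite μ] (n : ℕ) {g : (Fin (n + 1) → X) → ℝ≥0∞}
    (hg : Measurable g) :
    ∫⁻ x, g x ∂pm μ (n + 1) = ∫⁻ x, ∫⁻ y, g (Fin.snoc x y) ∂μ ∂pm μ n := by
  have h := (measurePreserving_piFinSuccAbove (fun _ : Fin (n + 1) => μ) (Fin.last n)).symm
  have hm : Measurable fun p : X × (Fin n → X) => g (Fin.snoc p.2 p.1) :=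
    hg.comp ((measurable_snoc n).comp measurable_swap)
  have e : ∫⁻ x, g x ∂pm μ (n + 1)
      = ∫⁻ p : X × (Fin n → X), g (Fin.snoc p.2 p.1) ∂(μ.prod (pm μ n)) := by
    unfold pm
    rw [← h.lintegral_comp hg]
    simp [MeasurableEquiv.piFinSuccAbove]
    rfl
  rw [e, lintegral_prod_symm _ hm.aemeasurable]

theorem lintegral_pm_zero (μ : Measure X) (g : (Fin 0 → X) → ℝ≥0∞) :
    ∫⁻ x, g x ∂pm μ 0 = g ![] := by
  unfold pm
  rw [Measure.pi_of_empty _ ![], lintegral_dirac]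

theorem measurable_lintegral_snoc (μ : Measure X) [SigmaFinite μ] {n : ℕ}
    {g : (Fin (n + 1) → X) → ℝ≥0∞} (hg : Measurable g) :
    Measurable fun x : Fin n → X => ∫⁻ y, g (Fin.snoc x y) ∂μ :=
  (hg.comp (measurable_snoc n)).lintegral_prod_right'

theorem measurable_t {ψ : ∀ n, (Fin n → X) → ℝ≥0∞} (hψ : IsStoppingRule ψ) :
    ∀ n, Measurable (t ψ n)
  | 0 => by simpa only [t] using measurable_const
  | 1 => by simpa only [t] using measurable_const
  | n + 2 => by
    simp only [t]
    exact ((measurable_t hψ (n + 1)).comp (measurable_init _)).mul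
      (measurable_const.sub ((hψ.1 (n + 1)).comp (measurable_init _)))

variable {μ : Measure X} {c : ℝ≥0∞} {fb l : ∀ n, (Fin n → X) → ℝ≥0∞} {N : ℕ}

theorem V_of_lt {n : ℕ} (h : n < N) (x : Fin n → X) :
    V μ c fb l N n x = min (l n x) (Q μ c fb l N n x) := by
  rw [V, dif_pos h, Q]

theorem V_self (x : Fin N → X) : V μ c fb l N N x = l N x := by
  rw [V, dif_neg (lt_irrefl N)]

theorem measurable_V [SigmaFinite μ] (hfb : ∀ n, Measurable (fb n)) (hl : ∀ n, Measurable (l n))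
    (n : ℕ) : Measurable (V μ c fb l N n) := by
  by_cases h : n < N
  · have ih := measurable_V hfb hl (n + 1)
    rw [funext (V_of_lt h)]
    exact (hl n).min (((hfb n).const_mul c).add (measurable_lintegral_snoc μ ih))
  · have e : V μ c fb l N n = l n := by
      funext x
      rw [V, dif_neg h]
    exact e ▸ hl n
termination_by N - n

theorem measurable_Q [SigmaFinite μ] (hfb : ∀ n, Measurable (fb n)) (hl : ∀ n, Measurable (l n))
    (n : ℕ) : Measurable (Q μ c fb l N n) :=
  ((hfb n).const_mul c).add (measurable_lintegral_snoc μ (measurable_V hfb hl (n + 1)))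

/-- The cost-to-go of not having stopped before stage `n` and continuing optimally. -/
noncomputable def continuationRisk (μ : Measure X) (c : ℝ≥0∞) (fb l ψ : ∀ n, (Fin n → X) → ℝ≥0∞)
    (N n : ℕ) : ℝ≥0∞ :=
  ∫⁻ x, t ψ n x * (c * (n : ℝ≥0∞) * fb n x + V μ c fb l N n x) ∂pm μ n

/-- The risk incurred by stopping at stage `n`. -/
noncomputable def stoppingRisk (μ : Measure X) (c : ℝ≥0∞) (fb l ψ : ∀ n, (Fin n → X) → ℝ≥0∞)
    (n : ℕ) : ℝ≥0∞ :=
  ∫⁻ x, s ψ n x * (c * (n : ℝ≥0∞) * fb n x + l n x) ∂pm μ n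

theorem lintegral_snoc_cost (hfb : ∀ n, Measurable (fb n))
    (hcons : ∀ n (x : Fin n → X), ∫⁻ y, fb (n + 1) (Fin.snoc x y) ∂μ = fb n x)
    (n : ℕ) (x : Fin n → X) :
    ∫⁻ y, (c * ((n + 1 : ℕ) : ℝ≥0∞) * fb (n + 1) (Fin.snoc x y)
        + V μ c fb l N (n + 1) (Fin.snoc x y)) ∂μ
      = c * (n : ℝ≥0∞) * fb n x + Q μ c fb l N n x := by
  have hs : Measurable fun y : X => (Fin.snoc x y : Fin (n + 1) → X) :=
    (measurable_snoc n).comp (measurable_const.prodMk measurable_id)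
  have hf1 : Measurable fun y : X => fb (n + 1) (Fin.snoc x y) := (hfb (n + 1)).comp hs
  rw [lintegral_add_left (hf1.const_mul _), lintegral_const_mul _ hf1, hcons, Q]
  push_cast
  ring

variable [SigmaFinite μ] {ψ : ∀ n, (Fin n → X) → ℝ≥0∞}

theorem continuationRisk_one (hfb : ∀ n, Measurable (fb n)) (hl : ∀ n, Measurable (l n))
    (hcons : ∀ n (x : Fin n → X), ∫⁻ y, fb (n + 1) (Fin.snoc x y) ∂μ = fb n x) :
    continuationRisk μ c fb l ψ N 1 = Q μ c fb l N 0 ![] := by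
  simp only [continuationRisk, t, one_mul]
  have hm : Measurable fun x => c * ((1 : ℕ) : ℝ≥0∞) * fb 1 x + V μ c fb l N 1 x :=
    ((hfb 1).const_mul _).add (measurable_V hfb hl 1)
  rw [lintegral_pm_succ μ 0 hm, lintegral_pm_zero]
  simpa using lintegral_snoc_cost (c := c) (l := l) (N := N) hfb hcons 0 ![]

theorem continuationRisk_succ (hfb : ∀ n, Measurable (fb n)) (hl : ∀ n, Measurable (l n))
    (hcons : ∀ n (x : Fin n → X), ∫⁻ y, fb (n + 1) (Fin.snoc x y) ∂μ = fb n x)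
    (hψ : IsStoppingRule ψ) {n : ℕ} (hn : 1 ≤ n) :
    continuationRisk μ c fb l ψ N (n + 1)
      = ∫⁻ x, t ψ n x * (1 - ψ n x) *
          (c * (n : ℝ≥0∞) * fb n x + Q μ c fb l N n x) ∂pm μ n := by
  have hm : Measurable fun x => c * ((n + 1 : ℕ) : ℝ≥0∞) * fb (n + 1) x
      + V μ c fb l N (n + 1) x := ((hfb _).const_mul _).add (measurable_V hfb hl _)
  have htm : Measurable fun x => t ψ (n + 1) x * (c * ((n + 1 : ℕ) : ℝ≥0∞) * fb (n + 1) x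
      + V μ c fb l N (n + 1) x) := (measurable_t hψ _).mul hm
  rw [continuationRisk, lintegral_pm_succ μ n htm]
  refine lintegral_congr fun x => ?_
  simp only [t_snoc ψ hn]
  rw [lintegral_const_mul, lintegral_snoc_cost hfb hcons]
  exact hm.comp ((measurable_snoc n).comp (measurable_const.prodMk measurable_id))

theorem stoppingRisk_add_continuationRisk (hfb : ∀ n, Measurable (fb n))
    (hl : ∀ n, Measurable (l n))
    (hcons : ∀ n (x : Fin n → X), ∫⁻ y, fb (n + 1) (Fin.snoc x y) ∂μ = fb n x)
    (hψ : IsStoppingRule ψ) {n : ℕ} (hn : 1 ≤ n) :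
    stoppingRisk μ c fb l ψ n + continuationRisk μ c fb l ψ N (n + 1)
      = ∫⁻ x, t ψ n x * (c * (n : ℝ≥0∞) * fb n x
          + (ψ n x * l n x + (1 - ψ n x) * Q μ c fb l N n x)) ∂pm μ n := by
  rw [continuationRisk_succ hfb hl hcons hψ hn, stoppingRisk, ← lintegral_add_left]
  · exact lintegral_congr fun x => weighted_convexCombination (hψ.2 n x)
  · exact ((measurable_t hψ n).mul (hψ.1 n)).mul (((hfb n).const_mul _).add (hl n))

theorem continuationRisk_le (hfb : ∀ n, Measurable (fb n)) (hl : ∀ n, Measurable (l n))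
    (hcons : ∀ n (x : Fin n → X), ∫⁻ y, fb (n + 1) (Fin.snoc x y) ∂μ = fb n x)
    (hψ : IsStoppingRule ψ) {n : ℕ} (hn : 1 ≤ n) (hnN : n < N) :
    continuationRisk μ c fb l ψ N n
      ≤ stoppingRisk μ c fb l ψ n + continuationRisk μ c fb l ψ N (n + 1) := by
  rw [stoppingRisk_add_continuationRisk hfb hl hcons hψ hn]
  refine lintegral_mono fun x => ?_
  simp only [V_of_lt hnN]
  gcongr
  exact min_le_convexCombination (hψ.2 n x) _ _

theorem continuationRisk_eq_iff (hfb : ∀ n, Measurable (fb n)) (hl : ∀ n, Measurable (l n))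
    (hcons : ∀ n (x : Fin n → X), ∫⁻ y, fb (n + 1) (Fin.snoc x y) ∂μ = fb n x)
    (hc : c ≠ ⊤) {n : ℕ} (hfin : ∀ᵐ x ∂pm μ n, fb n x ≠ ⊤)
    (hψ : IsStoppingRule ψ) (hn : 1 ≤ n) (hnN : n < N)
    (hA : continuationRisk μ c fb l ψ N n ≠ ⊤) :
    continuationRisk μ c fb l ψ N n
        = stoppingRisk μ c fb l ψ n + continuationRisk μ c fb l ψ N (n + 1) ↔
      ∀ᵐ x ∂pm μ n, 0 < t ψ n x →
        ((l n x < Q μ c fb l N n x → ψ n x = 1) ∧ (Q μ c fb l N n x < l n x → ψ n x = 0)) := by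
  rw [stoppingRisk_add_continuationRisk hfb hl hcons hψ hn]
  have hpt : ∀ᵐ x ∂pm μ n,
      (t ψ n x * (c * (n : ℝ≥0∞) * fb n x + V μ c fb l N n x)
        = t ψ n x * (c * (n : ℝ≥0∞) * fb n x
          + (ψ n x * l n x + (1 - ψ n x) * Q μ c fb l N n x)) ↔
      (0 < t ψ n x →
        ((l n x < Q μ c fb l N n x → ψ n x = 1) ∧
          (Q μ c fb l N n x < l n x → ψ n x = 0)))) := by
    filter_upwards [hfin] with x hx
    rcases eq_zero_or_pos (t ψ n x) with h0 | h0
    · simp [h0]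
    · have hk : c * (n : ℝ≥0∞) * fb n x ≠ ⊤ :=
        ENNReal.mul_ne_top (ENNReal.mul_ne_top hc (ENNReal.natCast_ne_top n)) hx
      rw [ENNReal.mul_right_inj h0.ne' (ne_top_of_le_ne_top one_ne_top (t_le_one ψ n x)),
        ENNReal.add_right_inj hk, V_of_lt hnN, min_eq_convexCombination_iff (hψ.2 n x)]
      simp [h0]
  rw [← Filter.eventually_congr hpt]
  constructor
  · intro e
    refine ae_eq_of_ae_le_of_lintegral_le (Eventually.of_forall fun x => ?_) hA ?_ e.ge
    · simp only [V_of_lt hnN]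
      gcongr
      exact min_le_convexCombination (hψ.2 n x) _ _
    · exact ((measurable_t hψ n).mul (((hfb n).const_mul _).add
        (((hψ.1 n).mul (hl n)).add
          ((measurable_const.sub (hψ.1 n)).mul (measurable_Q hfb hl n))))).aemeasurable
  · exact fun e => lintegral_congr_ae e

theorem sum_stoppingRisk_add_eq_iff (hfb : ∀ n, Measurable (fb n)) (hl : ∀ n, Measurable (l n))
    (hcons : ∀ n (x : Fin n → X), ∫⁻ y, fb (n + 1) (Fin.snoc x y) ∂μ = fb n x)
    (hc : c ≠ ⊤) (hfin : ∀ n, ∀ᵐ x ∂pm μ n, fb n x ≠ ⊤) (hψ : IsStoppingRule ψ)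
    (hQ : Q μ c fb l N 0 ![] ≠ ⊤) {k : ℕ} (hk : k + 1 ≤ N) :
    Q μ c fb l N 0 ![] ≤ (∑ i ∈ Finset.range k, stoppingRisk μ c fb l ψ (i + 1))
        + continuationRisk μ c fb l ψ N (k + 1) ∧
    ((∑ i ∈ Finset.range k, stoppingRisk μ c fb l ψ (i + 1))
        + continuationRisk μ c fb l ψ N (k + 1) = Q μ c fb l N 0 ![] ↔
      ∀ n : ℕ, 1 ≤ n → n ≤ k → ∀ᵐ x ∂pm μ n, 0 < t ψ n x →
        ((l n x < Q μ c fb l N n x → ψ n x = 1) ∧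
          (Q μ c fb l N n x < l n x → ψ n x = 0))) := by
  induction k with
  | zero =>
    simp only [Finset.range_zero, Finset.sum_empty, zero_add,
      continuationRisk_one hfb hl hcons, le_refl, true_and, true_iff]
    intro n h1 h2
    omega
  | succ k ih =>
    obtain ⟨ihle, iheq⟩ := ih (by omega)
    have hstep := continuationRisk_le (c := c) (N := N) hfb hl hcons hψ
      (Nat.le_add_left 1 k) (by omega)
    rw [Finset.sum_range_succ, add_assoc]
    have hle := add_le_add_right hstep (∑ i ∈ Finset.range k, stoppingRisk μ c fb l ψ (i + 1))
    refine ⟨ihle.trans hle, ?_⟩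
    have hkey : (∑ i ∈ Finset.range k, stoppingRisk μ c fb l ψ (i + 1))
        + continuationRisk μ c fb l ψ N (k + 1) = Q μ c fb l N 0 ![] →
        ((∑ i ∈ Finset.range k, stoppingRisk μ c fb l ψ (i + 1))
        + (stoppingRisk μ c fb l ψ (k + 1) + continuationRisk μ c fb l ψ N (k + 1 + 1))
          = Q μ c fb l N 0 ![] ↔
        ∀ᵐ x ∂pm μ (k + 1), 0 < t ψ (k + 1) x →
        ((l (k + 1) x < Q μ c fb l N (k + 1) x → ψ (k + 1) x = 1) ∧
          (Q μ c fb l N (k + 1) x < l (k + 1) x → ψ (k + 1) x = 0))) := by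
      intro e
      obtain ⟨hS, hA⟩ := ENNReal.add_ne_top.1 (e ▸ hQ)
      rw [← e, ENNReal.add_right_inj hS, eq_comm]
      exact continuationRisk_eq_iff hfb hl hcons hc (hfin _) hψ (by omega) (by omega) hA
    constructor
    · intro e
      have e' := le_antisymm (hle.trans e.le) ihle
      intro n h1 h2
      rcases Nat.lt_or_ge n (k + 1) with h | h
      · exact iheq.1 e' n h1 (by omega)
      · obtain rfl : n = k + 1 := by omega
        exact (hkey e').1 e
    · intro H
      have e' := iheq.2 fun n h1 h2 => H n h1 (by omega)
      exact (hkey e').2 (H (k + 1) (by omega) le_rfl)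

end Integration

end SDP

open SDP MeasureTheory ENNReal in
/-- for `ψ ∈ 𝓕ᴺ`, `R_N(ψ) = Q₀ᴺ` iff
`1{lₙ < Qₙᴺ} ≤ ψₙ ≤ 1{lₙ ≤ Qₙᴺ}` `μⁿ`-a.e. on `Tₙ^ψ`, for `n = 1,…,N−1`. -/
theorem statement_5
    {Θ X D : Type*} [MeasurableSpace Θ] [MeasurableSpace X] [MeasurableSpace D]
    (μ : Measure X) [SigmaFinite μ]
    (π₁ π₂ : Measure Θ) [IsProbabilityMeasure π₁] [IsProbabilityMeasure π₂]
    (f : Θ → ∀ n, (Fin n → X) → ℝ≥0∞) (hf : IsDensityFamily μ f)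
    (w : Θ → D → ℝ≥0∞) (hw : Measurable (Function.uncurry w))
    (δB : ∀ n, (Fin n → X) → D) (hδB : IsDecisionRule δB)
    (hBayes : ∀ n (d : D), ∀ᵐ x ∂pm μ n,
      ∫⁻ θ, w θ (δB n x) * f θ n x ∂π₁ ≤ ∫⁻ θ, w θ d * f θ n x ∂π₁)
    (l : ∀ n, (Fin n → X) → ℝ≥0∞)
    (hl : ∀ n x, l n x = ∫⁻ θ, w θ (δB n x) * f θ n x ∂π₁)
    (hl1 : ∫⁻ x, l 1 x ∂pm μ 1 < ⊤)
    (c : ℝ≥0∞) (hc : 0 < c) (hc' : c ≠ ⊤)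
    (N : ℕ) (hN : 2 ≤ N)
    (ψ : ∀ n, (Fin n → X) → ℝ≥0∞) (hψ : IsStoppingRule ψ) (hψN : TruncatedAt ψ N) :
    RN π₂ μ c f l N ψ = Q μ c (fbar π₂ f) l N 0 ![] ↔
      ∀ n : ℕ, 1 ≤ n → n ≤ N - 1 → ∀ᵐ x ∂pm μ n, 0 < t ψ n x →
        ({y : Fin n → X | l n y < Q μ c (fbar π₂ f) l N n y}.indicator 1 x ≤ ψ n x ∧
          ψ n x ≤ {y : Fin n → X | l n y ≤ Q μ c (fbar π₂ f) l N n y}.indicator 1 x) := by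
  have hfb : ∀ n, Measurable (fbar π₂ f n) := fun n => (hf.1 n).lintegral_prod_left'
  have hlm : ∀ n, Measurable (l n) := fun n => by
    rw [funext (hl n)]
    refine Measurable.lintegral_prod_left' (f := fun p : Θ × (Fin n → X) =>
      w p.1 (δB n p.2) * f p.1 n p.2) ?_
    exact (hw.comp (measurable_fst.prodMk ((hδB n).comp measurable_snd))).mul (hf.1 n)
  have hcons : ∀ n (x : Fin n → X),
      ∫⁻ y, fbar π₂ f (n + 1) (Fin.snoc x y) ∂μ = fbar π₂ f n x := fun n x => by
    simp only [fbar]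
    rw [lintegral_lintegral_swap]
    · exact lintegral_congr fun θ => hf.2.2.2 θ n x
    · exact ((hf.1 (n + 1)).comp (measurable_snd.prodMk
        ((measurable_snoc n).comp (measurable_const.prodMk measurable_fst)))).aemeasurable
  have hint : ∀ n, ∫⁻ x, fbar π₂ f n x ∂pm μ n = 1 := fun n => by
    simp only [fbar]
    have hm : Measurable (Function.uncurry fun (x : Fin n → X) θ => f θ n x) :=
      (hf.1 n).comp measurable_swap
    rw [lintegral_lintegral_swap hm.aemeasurable]
    simp [hf.2.2.1]
  have hfin : ∀ n, ∀ᵐ x ∂pm μ n, fbar π₂ f n x ≠ ⊤ := fun n => by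
    filter_upwards [ae_lt_top (hfb n) (by simp [hint n])] with x hx using hx.ne
  have hQ : Q μ c (fbar π₂ f) l N 0 ![] ≠ ⊤ := by
    rw [Q]
    refine ENNReal.add_ne_top.2 ⟨ENNReal.mul_ne_top hc' (by simp [fbar, hf.2.1]), ?_⟩
    refine ne_top_of_le_ne_top hl1.ne ?_
    rw [lintegral_pm_succ μ 0 (hlm 1), lintegral_pm_zero]
    refine lintegral_mono fun y => ?_
    rw [V_of_lt (by omega)]
    exact min_le_left _ _
  obtain ⟨M, rfl⟩ : ∃ M, N = M + 1 := ⟨N - 1, by omega⟩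
  have hRN : RN π₂ μ c f l (M + 1) ψ
      = (∑ i ∈ Finset.range M, stoppingRisk μ c (fbar π₂ f) l ψ (i + 1))
        + continuationRisk μ c (fbar π₂ f) l ψ (M + 1) (M + 1) := by
    simp [RN, stoppingRisk, continuationRisk, V_self]
  rw [hRN, (sum_stoppingRisk_add_eq_iff hfb hlm hcons hc' hfin hψ hQ le_rfl).2]
  refine forall_congr' fun n => forall_congr' fun _ => forall_congr' fun _ =>
    Filter.eventually_congr (Eventually.of_forall fun x => ?_)
  rw [indicator_one_bounds_iff x (hψ.2 n x)]
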